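/- arXiv:1604.07900 — 2 statements merged into one kernel-verified Lean document; each statement's English description precedes it below -/
import Mathlib

section
/- Let A and B be countable index types, let (a_α)_{α∈A} and (b_β)_{β∈B} be families of real numbers with ∑_{α∈A} a_α² < ∞ and ∑_{β∈B} b_β² < ∞, let M ∈ ℕ, and let J ⊆ A×B be such that for each fixed α ∈ A the set {β : (α,β) ∈ J} has at most M elements, and for each fixed β ∈ B the set {α : (α,β) ∈ J} has at most M elements. Then the family (a_α b_β)_{(α,β)∈J} is absolutely summable and ∑_{(α,β)∈J} |a_α b_β| ≤ M (∑_{α∈A} a_α²)^{1/2} (∑_{β∈B} b_β²)^{1/2}. -/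
/-- If every fiber of `f` has at most `M` elements, then finite sums of `g ∘ f` are bounded by
`M` times the sum of the nonnegative summable family `g`. -/
theorem sum_comp_le_mul_tsum_of_encard_fiber_le {ι A : Type*} (f : ι → A) (g : A → ℝ)
    (hg : ∀ x, 0 ≤ g x) (hs : Summable g) (M : ℕ)
    (hf : ∀ x, {i | f i = x}.encard ≤ (M : ℕ∞)) (s : Finset ι) :
    ∑ i ∈ s, g (f i) ≤ M * ∑' x, g x := by
  classical
  rw [Finset.sum_comp g f]
  calc ∑ x ∈ s.image f, (s.filter (fun i => f i = x)).card • g x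
      ≤ ∑ x ∈ s.image f, (M : ℝ) * g x := by
        refine Finset.sum_le_sum fun x _ => ?_
        rw [nsmul_eq_mul]
        refine mul_le_mul_of_nonneg_right ?_ (hg x)
        have hsub : ((s.filter (fun i => f i = x) : Finset ι) : Set ι) ⊆ {i | f i = x} := by
          intro i hi
          simpa using (Finset.mem_filter.mp hi).2
        have hcard := (Set.encard_le_encard hsub).trans (hf x)
        rw [Set.encard_coe_eq_coe_finsetCard] at hcard
        exact_mod_cast hcard
    _ = M * ∑ x ∈ s.image f, g x := by rw [Finset.mul_sum]
    _ ≤ M * ∑' x, g x :=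
        mul_le_mul_of_nonneg_left (hs.sum_le_tsum _ fun x _ => hg x) (Nat.cast_nonneg M)

/-- Cauchy–Schwarz for essentially diagonal sums: if every fiber of
`J ⊆ A × B` (in either direction) has at most `M` elements, then
`∑_{(α,β)∈J} |a_α b_β| ≤ M (∑ a_α²)^{1/2} (∑ b_β²)^{1/2}`. -/
theorem essentially_diagonal_cauchy_schwarz {A B : Type*} [Countable A] [Countable B]
    (a : A → ℝ) (b : B → ℝ)
    (ha : Summable (fun α => a α ^ 2)) (hb : Summable (fun β => b β ^ 2))
    (M : ℕ) (J : Set (A × B))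
    (hJA : ∀ α : A, {β : B | (α, β) ∈ J}.encard ≤ (M : ℕ∞))
    (hJB : ∀ β : B, {α : A | (α, β) ∈ J}.encard ≤ (M : ℕ∞)) :
    Summable (fun p : J => |a p.1.1 * b p.1.2|)
    ∧ ∑' p : J, |a p.1.1 * b p.1.2|
        ≤ M * Real.sqrt (∑' α, a α ^ 2) * Real.sqrt (∑' β, b β ^ 2) := by
  have hA : ∀ α, {p : J | p.1.1 = α}.encard ≤ (M : ℕ∞) := fun α => by
    refine (Set.encard_le_encard_of_injOn (f := fun p : J => p.1.2) ?_ ?_).trans (hJA α)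
    · rintro ⟨⟨x, y⟩, h⟩ rfl
      exact h
    · rintro ⟨⟨x, y⟩, h⟩ rfl ⟨⟨x₂, y₂⟩, h₂⟩ hx hy
      exact Subtype.ext (Prod.ext (Eq.symm hx) hy)
  have hB : ∀ β, {p : J | p.1.2 = β}.encard ≤ (M : ℕ∞) := fun β => by
    refine (Set.encard_le_encard_of_injOn (f := fun p : J => p.1.1) ?_ ?_).trans (hJB β)
    · rintro ⟨⟨x, y⟩, h⟩ rfl
      exact h
    · rintro ⟨⟨x, y⟩, h⟩ rfl ⟨⟨x₂, y₂⟩, h₂⟩ hy hx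
      exact Subtype.ext (Prod.ext hx (Eq.symm hy))
  have key : ∀ s : Finset J, ∑ p ∈ s, |a p.1.1 * b p.1.2|
      ≤ M * Real.sqrt (∑' α, a α ^ 2) * Real.sqrt (∑' β, b β ^ 2) := fun s => by
    calc ∑ p ∈ s, |a p.1.1 * b p.1.2|
        ≤ √(∑ p ∈ s, a p.1.1 ^ 2) * √(∑ p ∈ s, b p.1.2 ^ 2) := by
          simpa [abs_mul] using
            Real.sum_mul_le_sqrt_mul_sqrt s (fun p => |a p.1.1|) (fun p => |b p.1.2|)
      _ ≤ √(M * ∑' α, a α ^ 2) * √(M * ∑' β, b β ^ 2) := by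
          gcongr
          · exact sum_comp_le_mul_tsum_of_encard_fiber_le (fun p : J => p.1.1) (fun x => a x ^ 2)
              (fun _ => sq_nonneg _) ha M hA s
          · exact sum_comp_le_mul_tsum_of_encard_fiber_le (fun p : J => p.1.2) (fun x => b x ^ 2)
              (fun _ => sq_nonneg _) hb M hB s
      _ = M * √(∑' α, a α ^ 2) * √(∑' β, b β ^ 2) := by
          rw [Real.sqrt_mul (Nat.cast_nonneg M), Real.sqrt_mul (Nat.cast_nonneg M),
            mul_mul_mul_comm, Real.mul_self_sqrt (Nat.cast_nonneg M), mul_assoc]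
  exact ⟨summable_of_sum_le (fun _ => abs_nonneg _) key,
    Real.tsum_le_of_sum_le (fun _ => abs_nonneg _) key⟩
end

section
/- Let (τ⁰, ξ⁰), (τ¹, ξ¹), (τ², ξ²) ∈ ℝ × ℝ^d satisfy τ⁰ + τ¹ + τ² = 0 and ξ⁰ + ξ¹ + ξ² = 0, with all ξⁱ ≠ 0 and |ξ²| ≤ min(|ξ⁰|, |ξ¹|). Set D := |τ⁰ + |ξ⁰|| + |τ¹ − |ξ¹|| + |τ² − |ξ²|| (the sum of the distances of the three points to the characteristic cones with sign pattern (−, +, +)). Then |ξ²| · ∠(ξ¹, ξ²)² ≤ 16 D and |ξ²| · ∠(−ξ⁰, ξ²)² ≤ 16 D. -/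
open InnerProductGeometry

/-- A quadratic lower bound for the cosine defect of an angle. -/
theorem sq_angle_le_five_mul_one_sub_cos {V : Type*} [NormedAddCommGroup V]
    [InnerProductSpace ℝ V] (x y : V) :
    angle x y ^ 2 ≤ 5 * (1 - Real.cos (angle x y)) := by
  have hcos : Real.cos (angle x y) ≤ 1 - 2 / Real.pi ^ 2 * angle x y ^ 2 :=
    Real.cos_le_one_sub_mul_cos_sq <| by
      rw [abs_of_nonneg (angle_nonneg x y)]
      exact angle_le_pi x y
  have hpi : 1 / 5 ≤ 2 / Real.pi ^ 2 := by
    rw [div_le_div_iff₀ (by norm_num) (by positivity)]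
    nlinarith [Real.pi_lt_d2, Real.pi_pos]
  nlinarith [sq_nonneg (angle x y)]

/-- The defect in the triangle inequality controls the angle between the two summands. -/
theorem norm_mul_sq_angle_le_triangle_defect {V : Type*} [NormedAddCommGroup V]
    [InnerProductSpace ℝ V] {x y : V} (hx : x ≠ 0) (hyx : ‖y‖ ≤ ‖x‖) :
    ‖y‖ * angle x y ^ 2 ≤ 10 * (‖x‖ + ‖y‖ - ‖x + y‖) := by
  have hpos : 0 < ‖x‖ := norm_pos_iff.mpr hx
  have htri := norm_add_le x y
  have hsq := norm_add_sq_real x y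
  rw [← cos_angle_mul_norm_mul_norm] at hsq
  have hdefect : ‖y‖ * (1 - Real.cos (angle x y)) ≤ 2 * (‖x‖ + ‖y‖ - ‖x + y‖) := by
    refine le_of_mul_le_mul_left ?_ hpos
    nlinarith [mul_nonneg (sub_nonneg.mpr htri)
      (by linarith : 0 ≤ 4 * ‖x‖ - (‖x‖ + ‖y‖ + ‖x + y‖))]
  nlinarith [mul_le_mul_of_nonneg_left (sq_angle_le_five_mul_one_sub_cos x y) (norm_nonneg y)]

/-- The defect in the reverse triangle inequality controls the angle. -/
theorem norm_mul_sq_angle_le_reverse_triangle_defect {V : Type*} [NormedAddCommGroup V]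
    [InnerProductSpace ℝ V] {x y : V} (hx : x ≠ 0) :
    ‖y‖ * angle x y ^ 2 ≤ 5 * (‖x - y‖ + ‖y‖ - ‖x‖) := by
  have hpos : 0 < ‖x‖ := norm_pos_iff.mpr hx
  have htri := norm_sub_le x y
  have hrev := norm_sub_norm_le x y
  have hsq := norm_sub_sq_real x y
  rw [← cos_angle_mul_norm_mul_norm] at hsq
  have hdefect : ‖y‖ * (1 - Real.cos (angle x y)) ≤ ‖x - y‖ + ‖y‖ - ‖x‖ := by
    refine le_of_mul_le_mul_left ?_ hpos
    nlinarith [mul_nonneg (by linarith : 0 ≤ ‖x - y‖ + ‖y‖ - ‖x‖)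
      (by linarith : 0 ≤ 2 * ‖x‖ - (‖x - y‖ + ‖x‖ - ‖y‖))]
  nlinarith [mul_le_mul_of_nonneg_left (sq_angle_le_five_mul_one_sub_cos x y) (norm_nonneg y)]

/-- Geometry of the cone: for a zero-sum triple of space-time
frequencies with sign pattern `(−, +, +)` and `|ξ²|` minimal, the angles between the
spatial frequencies are controlled by the total distance `D` to the characteristic
cones: `|ξ²| ∠(ξ¹, ξ²)² ≤ 16 D` and `|ξ²| ∠(−ξ⁰, ξ²)² ≤ 16 D`. -/
theorem geometry_of_the_cone (d : ℕ) (τ0 τ1 τ2 : ℝ)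
    (ξ0 ξ1 ξ2 : EuclideanSpace ℝ (Fin d))
    (hτ : τ0 + τ1 + τ2 = 0) (hξ : ξ0 + ξ1 + ξ2 = 0)
    (h0 : ξ0 ≠ 0) (h1 : ξ1 ≠ 0) (h2 : ξ2 ≠ 0)
    (hmin : ‖ξ2‖ ≤ min ‖ξ0‖ ‖ξ1‖)
    (D : ℝ) (hD : D = |τ0 + ‖ξ0‖| + |τ1 - ‖ξ1‖| + |τ2 - ‖ξ2‖|) :
    ‖ξ2‖ * (angle ξ1 ξ2) ^ 2 ≤ 16 * D
    ∧ ‖ξ2‖ * (angle (-ξ0) ξ2) ^ 2 ≤ 16 * D := by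
  have hsum : -ξ0 = ξ1 + ξ2 := by
    rw [neg_eq_iff_add_eq_zero, ← add_assoc, hξ]
  have hdiff : -ξ0 - ξ2 = ξ1 := by rw [hsum, add_sub_cancel_right]
  have hdefect : ‖ξ1‖ + ‖ξ2‖ - ‖ξ0‖ ≤ D := by
    linarith [neg_abs_le (τ0 + ‖ξ0‖), neg_abs_le (τ1 - ‖ξ1‖), neg_abs_le (τ2 - ‖ξ2‖)]
  have hD0 : 0 ≤ D := by rw [hD]; positivity
  have hfirst := norm_mul_sq_angle_le_triangle_defect h1 (hmin.trans (min_le_right _ _))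
  have hsecond := norm_mul_sq_angle_le_reverse_triangle_defect (y := ξ2) (neg_ne_zero.mpr h0)
  rw [← hsum, norm_neg] at hfirst
  rw [hdiff, norm_neg] at hsecond
  constructor <;> linarith
end
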